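/- arXiv:2411.05097 — 2 statements merged into one kernel-verified Lean document; each statement's English description precedes it below -/
import Mathlib

section
/- Diameter bound for average-link: for every k with 2 ≤ k ≤ n and every execution of average-link on a finite metric space with n points, every cluster S of the k-clustering A^k satisfies diam(S) ≤ min{k, 1 + 4·ln n} · k^{log₂ 3} · OPT_AV(k). -/
open Finset

/-- Average distance between two finite sets of points. -/
noncomputable def avgD {X : Type*} (d : X → X → ℝ) (A B : Finset X) : ℝ :=
  (∑ a ∈ A, ∑ b ∈ B, d a b) / ((A.card : ℝ) * (B.card : ℝ))

/-- The diameter of a finite set. -/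
noncomputable def diamF {X : Type*} (d : X → X → ℝ) (C : Finset X) : ℝ :=
  sSup {r : ℝ | ∃ x ∈ C, ∃ y ∈ C, r = d x y}

/-- A `k`-clustering of `X`: a partition of all points of `X` into `k` nonempty clusters. -/
def IsClustering {X : Type*} (𝒞 : Finset (Finset X)) (k : ℕ) : Prop :=
  𝒞.card = k ∧ (∀ C ∈ 𝒞, C.Nonempty) ∧
    (∀ C ∈ 𝒞, ∀ C' ∈ 𝒞, C ≠ C' → Disjoint C C') ∧ (∀ x : X, ∃ C ∈ 𝒞, x ∈ C)

/-- `avg-diam(𝒞) = (1/k) · Σ_{C ∈ 𝒞} diam(C)` (for a `k`-clustering, `𝒞.card = k`). -/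
noncomputable def avgDiam {X : Type*} (d : X → X → ℝ) (𝒞 : Finset (Finset X)) : ℝ :=
  (∑ C ∈ 𝒞, diamF d C) / (𝒞.card : ℝ)

/-- An execution of average-link. -/
structure AvgLinkExec (X : Type*) [Fintype X] [DecidableEq X] (d : X → X → ℝ) where
  part : ℕ → Finset (Finset X)
  init : part (Fintype.card X) = Finset.univ.image (fun x : X => ({x} : Finset X))
  merge : ∀ k : ℕ, 1 ≤ k → k < Fintype.card X →
    ∃ A ∈ part (k + 1), ∃ B ∈ part (k + 1), A ≠ B ∧
      (∀ A' ∈ part (k + 1), ∀ B' ∈ part (k + 1), A' ≠ B' → avgD d A B ≤ avgD d A' B') ∧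
      part k = insert (A ∪ B) (((part (k + 1)).erase A).erase B)

/-! ### Diameters and average distances -/

lemma dist_le_diamF {X : Type*} [MetricSpace X] {C : Finset X} {x y : X}
    (hx : x ∈ C) (hy : y ∈ C) : dist x y ≤ diamF dist C := by
  refine le_csSup ?_ ⟨x, hx, y, hy, rfl⟩
  refine ((C ×ˢ C).finite_toSet.image fun q : X × X => dist q.1 q.2).bddAbove.mono ?_
  rintro r ⟨u, hu, v, hv, rfl⟩
  exact ⟨(u, v), by simp [hu, hv], rfl⟩

lemma diamF_nonneg {X : Type*} [MetricSpace X] (C : Finset X) : 0 ≤ diamF dist C := by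
  apply Real.sSup_nonneg
  rintro r ⟨x, -, y, -, rfl⟩
  exact dist_nonneg

lemma diamF_le {X : Type*} [MetricSpace X] {C : Finset X} {c : ℝ} (hC : C.Nonempty)
    (h : ∀ x ∈ C, ∀ y ∈ C, dist x y ≤ c) : diamF dist C ≤ c := by
  obtain ⟨a, ha⟩ := hC
  refine csSup_le ⟨_, a, ha, a, ha, rfl⟩ ?_
  rintro r ⟨x, hx, y, hy, rfl⟩
  exact h x hx y hy

lemma sum_eq_card_mul_avgD {X : Type*} (d : X → X → ℝ) {A B : Finset X}
    (hA : A.Nonempty) (hB : B.Nonempty) :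
    ∑ a ∈ A, ∑ b ∈ B, d a b = (A.card : ℝ) * B.card * avgD d A B := by
  have hA' : (A.card : ℝ) ≠ 0 := by exact_mod_cast hA.card_pos.ne'
  have hB' : (B.card : ℝ) ≠ 0 := by exact_mod_cast hB.card_pos.ne'
  unfold avgD
  field_simp

lemma avgD_le {X : Type*} {d : X → X → ℝ} {A B : Finset X} {c : ℝ}
    (hA : A.Nonempty) (hB : B.Nonempty) (h : ∀ a ∈ A, ∀ b ∈ B, d a b ≤ c) :
    avgD d A B ≤ c := by
  have hA' : (0 : ℝ) < A.card := by exact_mod_cast hA.card_pos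
  have hB' : (0 : ℝ) < B.card := by exact_mod_cast hB.card_pos
  unfold avgD
  rw [div_le_iff₀ (by positivity)]
  calc ∑ a ∈ A, ∑ b ∈ B, d a b ≤ ∑ a ∈ A, ∑ b ∈ B, c :=
        sum_le_sum fun a ha => sum_le_sum fun b hb => h a ha b hb
    _ = c * (A.card * B.card) := by simp; ring

lemma exists_le_avgD {X : Type*} (d : X → X → ℝ) {A B : Finset X}
    (hA : A.Nonempty) (hB : B.Nonempty) : ∃ a ∈ A, ∃ b ∈ B, d a b ≤ avgD d A B := by
  by_contra! h
  have hlt : ∑ a ∈ A, ∑ b ∈ B, avgD d A B < ∑ a ∈ A, ∑ b ∈ B, d a b :=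
    sum_lt_sum_of_nonempty hA fun a ha => sum_lt_sum_of_nonempty hB fun b hb => h a ha b hb
  rw [sum_eq_card_mul_avgD d hA hB] at hlt
  simp only [sum_const, nsmul_eq_mul] at hlt
  linarith

/-! ### The growth exponent `log₂ 3 - 1` -/

/-- The exponent `p` with `2 ^ p = 3 / 2`. -/
noncomputable def linkExp : ℝ := Real.logb 2 3 - 1

lemma linkExp_pos : 0 < linkExp := by
  have : Real.logb 2 2 < Real.logb 2 3 :=
    Real.logb_lt_logb (by norm_num) (by norm_num) (by norm_num)
  rw [Real.logb_self_eq_one (by norm_num)] at this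
  unfold linkExp
  linarith

lemma two_rpow_linkExp : (2 : ℝ) ^ linkExp = 3 / 2 := by
  rw [linkExp, Real.rpow_sub (by norm_num), Real.rpow_logb (by norm_num) (by norm_num)
    (by norm_num), Real.rpow_one]

lemma rpow_linkExp_harmonic {a b : ℝ} (ha : 0 ≤ a) (hb : 0 ≤ b) :
    3 * (a ^ linkExp * b ^ linkExp) ≤ (a + b) ^ linkExp * (a ^ linkExp + b ^ linkExp) := by
  have hA := Real.rpow_nonneg ha linkExp
  have hB := Real.rpow_nonneg hb linkExp
  have hN := Real.rpow_nonneg (add_nonneg ha hb) linkExp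
  have key : 9 * (a ^ linkExp * b ^ linkExp) ≤ 4 * ((a + b) ^ linkExp) ^ 2 := by
    have h1 : (2 : ℝ) ^ linkExp * 2 ^ linkExp * (a ^ linkExp * b ^ linkExp)
        ≤ (a + b) ^ linkExp * (a + b) ^ linkExp := by
      rw [← Real.mul_rpow ha hb, ← Real.mul_rpow (by norm_num) (by norm_num),
        ← Real.mul_rpow (by norm_num) (by positivity),
        ← Real.mul_rpow (by positivity) (by positivity)]
      exact Real.rpow_le_rpow (by positivity) (by nlinarith [sq_nonneg (a - b)])
        linkExp_pos.le
    rw [two_rpow_linkExp] at h1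
    nlinarith
  refine le_of_sq_le_sq ?_ (by positivity)
  nlinarith [mul_le_mul_of_nonneg_right key (mul_nonneg hA hB),
    mul_nonneg (sq_nonneg ((a + b) ^ linkExp)) (sq_nonneg (a ^ linkExp - b ^ linkExp))]

lemma link_growth_of_le {a b s t x y : ℝ} (ha : 0 ≤ a) (hb : 0 ≤ b) (hs : 0 ≤ s) (ht : 0 ≤ t)
    (hx : x ≤ a ^ linkExp * s) (hy : y ≤ b ^ linkExp * t) (hx0 : 0 ≤ x) (hxy : x ≤ y) :
    2 * x + y ≤ (a + b) ^ linkExp * (s + t) := by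
  have hH := rpow_linkExp_harmonic ha hb
  have hBN : b ^ linkExp ≤ (a + b) ^ linkExp :=
    Real.rpow_le_rpow hb (by linarith) linkExp_pos.le
  have hA := Real.rpow_nonneg ha linkExp
  have hB := Real.rpow_nonneg hb linkExp
  generalize a ^ linkExp = A at *
  generalize b ^ linkExp = B at *
  generalize (a + b) ^ linkExp = N at *
  rcases hA.eq_or_lt with rfl | hA
  · nlinarith
  rcases hB.eq_or_lt with rfl | hB
  · nlinarith
  have hN : 0 < N := hB.trans_le hBN
  have h1 : x / A ≤ s := by rw [div_le_iff₀ hA]; linarith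
  have h2 : y / B ≤ t := by rw [div_le_iff₀ hB]; linarith
  have h3 : 3 ≤ N / A + N / B := by
    rw [div_add_div _ _ hA.ne' hB.ne', le_div_iff₀ (by positivity)]; linarith
  have h4 : 1 ≤ N / B := by rw [le_div_iff₀ hB]; linarith
  calc 2 * x + y ≤ (N / A + N / B) * x + N / B * (y - x) := by nlinarith
    _ = N * (x / A + y / B) := by field_simp; ring
    _ ≤ N * (s + t) := by gcongr

/-- The growth inequality: joining two groups at distance at most the smaller of their
diameters preserves a bound of the form `(size) ^ linkExp * (total weight)`. -/
lemma link_growth {a b s t m : ℝ} (ha : 0 ≤ a) (hb : 0 ≤ b) (hs : 0 ≤ s) (ht : 0 ≤ t)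
    (hm1 : m ≤ a ^ linkExp * s) (hm2 : m ≤ b ^ linkExp * t) :
    a ^ linkExp * s + m + b ^ linkExp * t ≤ (a + b) ^ linkExp * (s + t) := by
  rcases le_total (a ^ linkExp * s) (b ^ linkExp * t) with h | h
  · have := link_growth_of_le ha hb hs ht le_rfl le_rfl (by positivity) h
    linarith
  · have := link_growth_of_le hb ha ht hs le_rfl le_rfl (by positivity) h
    rw [add_comm b, add_comm t] at this
    linarith

/-! ### Merging two clusters of a partition -/

/-- The partition obtained from `P` by merging `A` and `B`. -/
def mergeClusters {X : Type*} [DecidableEq X] (P : Finset (Finset X)) (A B : Finset X) :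
    Finset (Finset X) :=
  insert (A ∪ B) ((P.erase A).erase B)

lemma mem_mergeClusters {X : Type*} [DecidableEq X] {P : Finset (Finset X)}
    {A B C : Finset X} :
    C ∈ mergeClusters P A B ↔ C = A ∪ B ∨ (C ∈ P ∧ C ≠ A ∧ C ≠ B) := by
  simp only [mergeClusters, mem_insert, mem_erase]
  tauto

lemma mergeClusters_comm {X : Type*} [DecidableEq X] (P : Finset (Finset X))
    (A B : Finset X) : mergeClusters P A B = mergeClusters P B A := by
  ext C
  simp only [mem_mergeClusters, union_comm A B]
  tauto

lemma IsClustering.eq_of_mem {X : Type*} {P : Finset (Finset X)} {k : ℕ}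
    (hP : IsClustering P k) {C C' : Finset X} {x : X} (hC : C ∈ P) (hC' : C' ∈ P)
    (hx : x ∈ C) (hx' : x ∈ C') : C = C' := by
  by_contra hne
  exact disjoint_left.1 (hP.2.2.1 C hC C' hC' hne) hx hx'

lemma isClustering_singletons (X : Type*) [Fintype X] [DecidableEq X] :
    IsClustering (univ.image fun x : X => ({x} : Finset X)) (Fintype.card X) := by
  refine ⟨?_, ?_, ?_, fun x => ⟨{x}, by simp, by simp⟩⟩
  · rw [card_image_of_injective _ singleton_injective, card_univ]
  · simp
  · simp only [mem_image, mem_univ, true_and, forall_exists_index, forall_apply_eq_imp_iff]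
    intro a b hab
    simpa using fun h : a = b => hab (by rw [h])

lemma IsClustering.mergeClusters {X : Type*} [DecidableEq X] {P : Finset (Finset X)} {k : ℕ}
    (hP : IsClustering P (k + 1)) {A B : Finset X} (hA : A ∈ P) (hB : B ∈ P) (hAB : A ≠ B) :
    IsClustering (mergeClusters P A B) k := by
  have hd : ∀ C ∈ P, C ≠ A → C ≠ B → Disjoint (A ∪ B) C := fun C hC h1 h2 =>
    disjoint_union_left.2 ⟨hP.2.2.1 A hA C hC h1.symm, hP.2.2.1 B hB C hC h2.symm⟩
  refine ⟨?_, ?_, ?_, ?_⟩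
  · have hnot : A ∪ B ∉ (P.erase A).erase B := by
      intro h
      simp only [mem_erase] at h
      obtain ⟨a, ha⟩ := hP.2.1 A hA
      exact h.2.1 (hP.eq_of_mem h.2.2 hA (mem_union_left _ ha) ha)
    have hB' : B ∈ P.erase A := mem_erase.2 ⟨hAB.symm, hB⟩
    rw [_root_.mergeClusters, card_insert_of_notMem hnot, card_erase_of_mem hB',
      card_erase_of_mem hA, hP.1]
    have := card_pos.2 ⟨B, hB'⟩
    rw [card_erase_of_mem hA, hP.1] at this
    omega
  · intro C hC
    rcases mem_mergeClusters.1 hC with rfl | ⟨hC, -, -⟩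
    · exact (hP.2.1 A hA).mono subset_union_left
    · exact hP.2.1 C hC
  · intro C hC C' hC' hne
    rcases mem_mergeClusters.1 hC with rfl | ⟨hC, h1, h2⟩ <;>
      rcases mem_mergeClusters.1 hC' with rfl | ⟨hC', h3, h4⟩
    · exact absurd rfl hne
    · exact hd C' hC' h3 h4
    · exact (hd C hC h1 h2).symm
    · exact hP.2.2.1 C hC C' hC' hne
  · intro x
    obtain ⟨C, hC, hx⟩ := hP.2.2.2 x
    by_cases h1 : C = A
    · exact ⟨A ∪ B, mem_mergeClusters.2 (.inl rfl), mem_union_left _ (h1 ▸ hx)⟩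
    by_cases h2 : C = B
    · exact ⟨A ∪ B, mem_mergeClusters.2 (.inl rfl), mem_union_right _ (h2 ▸ hx)⟩
    exact ⟨C, mem_mergeClusters.2 (.inr ⟨hC, h1, h2⟩), hx⟩

/-! ### Grouping the clusters -/

/-- Label `i` is active when at least two clusters of `P` carry it. -/
def ActiveLabel {X ι : Type*} (P : Finset (Finset X)) (l : X → ι) (i : ι) : Prop :=
  ∃ C ∈ P, ∃ C' ∈ P, C ≠ C' ∧ (∃ u ∈ C, l u = i) ∧ ∃ v ∈ C', l v = i

/-- A grouping of the clusters of `P`: the clusters are labelled by `ι`, label `i` owns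
`size i` units of size and `weight i` of the total weight `σ`, and the diameter of every group
with at least two clusters is bounded by `size ^ linkExp * weight`. -/
structure IsGrouping {X ι : Type*} [MetricSpace X] [Fintype ι] (P : Finset (Finset X)) (σ : ℝ)
    (l : X → ι) (size weight : ι → ℝ) : Prop where
  size_nonneg : ∀ i, 0 ≤ size i
  weight_nonneg : ∀ i, 0 ≤ weight i
  sum_size : ∑ i, size i ≤ Fintype.card ι
  sum_weight : ∑ i, weight i ≤ σ
  const : ∀ C ∈ P, ∀ x ∈ C, ∀ y ∈ C, l x = l y
  bound : ∀ i, ActiveLabel P l i → ∀ x y, l x = i → l y = i →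
    dist x y ≤ size i ^ linkExp * weight i

lemma ActiveLabel.of_merge {X ι : Type*} [DecidableEq X] {P : Finset (Finset X)}
    {A B : Finset X} {l : X → ι} {i : ι} (hA : A ∈ P) (hB : B ∈ P)
    (h : ActiveLabel (mergeClusters P A B) l i) : ActiveLabel P l i := by
  obtain ⟨C, hC, C', hC', hne, ⟨u, hu, hui⟩, v, hv, hvi⟩ := h
  rcases mem_mergeClusters.1 hC with rfl | ⟨hC, h1, h2⟩ <;>
    rcases mem_mergeClusters.1 hC' with rfl | ⟨hC', h3, h4⟩
  · exact absurd rfl hne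
  · rcases mem_union.1 hu with hu | hu
    · exact ⟨A, hA, C', hC', h3.symm, ⟨u, hu, hui⟩, v, hv, hvi⟩
    · exact ⟨B, hB, C', hC', h4.symm, ⟨u, hu, hui⟩, v, hv, hvi⟩
  · rcases mem_union.1 hv with hv | hv
    · exact ⟨C, hC, A, hA, h1, ⟨u, hu, hui⟩, v, hv, hvi⟩
    · exact ⟨C, hC, B, hB, h2, ⟨u, hu, hui⟩, v, hv, hvi⟩
  · exact ⟨C, hC, C', hC', hne, ⟨u, hu, hui⟩, v, hv, hvi⟩

lemma IsClustering.exists_activeLabel {X ι : Type*} [Fintype ι] {P : Finset (Finset X)} {m : ℕ}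
    (hP : IsClustering P m) (hm : Fintype.card ι < m) (l : X → ι) :
    ∃ i, ActiveLabel P l i := by
  choose r hr using fun C : P => hP.2.1 C.1 C.2
  obtain ⟨C, C', hne, heq⟩ := Fintype.exists_ne_map_eq_of_card_lt (fun C : P => l (r C))
    (by rw [Fintype.card_coe, hP.1]; exact hm)
  exact ⟨l (r C), C, C.2, C', C'.2, fun h => hne (Subtype.ext h), ⟨r C, hr C, rfl⟩,
    r C', hr C', heq.symm⟩

namespace IsGrouping

variable {X ι : Type*} [MetricSpace X] [Fintype ι] {P : Finset (Finset X)} {σ : ℝ}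
  {l : X → ι} {size weight : ι → ℝ}

lemma bound_le (h : IsGrouping P σ l size weight) (i : ι) :
    size i ^ linkExp * weight i ≤ (Fintype.card ι : ℝ) ^ linkExp * σ := by
  have h1 : size i ≤ Fintype.card ι :=
    (single_le_sum (fun j _ => h.size_nonneg j) (mem_univ i)).trans h.sum_size
  have h2 : weight i ≤ σ :=
    (single_le_sum (fun j _ => h.weight_nonneg j) (mem_univ i)).trans h.sum_weight
  exact mul_le_mul (Real.rpow_le_rpow (h.size_nonneg i) h1 linkExp_pos.le) h2
    (h.weight_nonneg i) (by positivity)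

lemma avgD_le_of_active (h : IsGrouping P σ l size weight)
    {A B : Finset X} (hmin : ∀ A' ∈ P, ∀ B' ∈ P, A' ≠ B' → avgD dist A B ≤ avgD dist A' B')
    {i : ι} (hi : ActiveLabel P l i) : avgD dist A B ≤ size i ^ linkExp * weight i := by
  have hi' := hi
  obtain ⟨C, hC, C', hC', hne, ⟨u, hu, hui⟩, v, hv, hvi⟩ := hi'
  refine (hmin C hC C' hC' hne).trans (avgD_le ⟨u, hu⟩ ⟨v, hv⟩ fun a ha b hb => ?_)
  exact h.bound i hi a b ((h.const C hC a ha u hu).trans hui)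
    ((h.const C' hC' b hb v hv).trans hvi)

/-- Merging two clusters with the same label. -/
lemma merge_same [DecidableEq X] (h : IsGrouping P σ l size weight) {A B : Finset X}
    (hA : A ∈ P) (hB : B ∈ P) {a b : X} (ha : a ∈ A) (hb : b ∈ B) (hab : l a = l b) :
    IsGrouping (mergeClusters P A B) σ l size weight where
  size_nonneg := h.size_nonneg
  weight_nonneg := h.weight_nonneg
  sum_size := h.sum_size
  sum_weight := h.sum_weight
  const := by
    intro C hC x hx y hy
    rcases mem_mergeClusters.1 hC with rfl | ⟨hC, -, -⟩
    · have key : ∀ z ∈ A ∪ B, l z = l a := by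
        intro z hz
        rcases mem_union.1 hz with hz | hz
        · exact h.const A hA z hz a ha
        · exact (h.const B hB z hz b hb).trans hab.symm
      rw [key x hx, key y hy]
    · exact h.const C hC x hx y hy
  bound i hi := h.bound i (hi.of_merge hA hB)

open Classical in
/-- Merging a cluster `A` into a cluster `B` whose label is not active: the points of `A` move
to the group of `B`. -/
lemma merge_inactive [DecidableEq X] (h : IsGrouping P σ l size weight) {m : ℕ}
    (hP : IsClustering P m) {A B : Finset X} (hA : A ∈ P) (hB : B ∈ P) {b : X} (hb : b ∈ B)
    (hact : ¬ ActiveLabel P l (l b)) :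
    IsGrouping (mergeClusters P A B) σ (fun x => if x ∈ A then l b else l x) size weight where
  size_nonneg := h.size_nonneg
  weight_nonneg := h.weight_nonneg
  sum_size := h.sum_size
  sum_weight := h.sum_weight
  const := by
    intro C hC x hx y hy
    rcases mem_mergeClusters.1 hC with rfl | ⟨hC, h1, -⟩
    · have key : ∀ z ∈ A ∪ B, (if z ∈ A then l b else l z) = l b := by
        intro z hz
        split_ifs with hzA
        · rfl
        · exact h.const B hB z ((mem_union.1 hz).resolve_left hzA) b hb
      simp only [key x hx, key y hy]
    · have key : ∀ z ∈ C, z ∉ A := fun z hz hzA => h1 (hP.eq_of_mem hC hA hz hzA)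
      simp only [key x hx, key y hy, if_false]
      exact h.const C hC x hx y hy
  bound := by
    have key : ∀ C ∈ mergeClusters P A B, (∃ u ∈ C, (if u ∈ A then l b else l u) = l b) →
        C = A ∪ B := by
      rintro C hC ⟨u, hu, hub⟩
      rcases mem_mergeClusters.1 hC with rfl | ⟨hC, h1, h2⟩
      · rfl
      · rw [if_neg fun huA => h1 (hP.eq_of_mem hC hA hu huA)] at hub
        exact absurd ⟨C, hC, B, hB, h2, ⟨u, hu, hub⟩, b, hb, rfl⟩ hact
    intro i hi
    by_cases hib : i = l b
    · subst hib
      obtain ⟨C, hC, C', hC', hne, hu, hv⟩ := hi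
      exact absurd ((key C hC hu).trans (key C' hC' hv).symm) hne
    have hold : ∀ z, (if z ∈ A then l b else l z) = i → l z = i := by
      intro z hz
      split_ifs at hz with hzA
      · exact absurd hz.symm hib
      · exact hz
    obtain ⟨C, hC, C', hC', hne, ⟨u, hu, hui⟩, v, hv, hvi⟩ := hi
    have hi' : ActiveLabel P l i := ActiveLabel.of_merge hA hB
      ⟨C, hC, C', hC', hne, ⟨u, hu, hold u hui⟩, v, hv, hold v hvi⟩
    exact fun x y hx hy => h.bound i hi' x y (hold x hx) (hold y hy)

open Classical in
/-- Merging two clusters from different active groups: the groups are joined. -/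
lemma merge_active [DecidableEq X] (h : IsGrouping P σ l size weight)
    {A B : Finset X} (hA : A ∈ P) (hB : B ∈ P)
    (hmin : ∀ A' ∈ P, ∀ B' ∈ P, A' ≠ B' → avgD dist A B ≤ avgD dist A' B')
    {a b : X} (ha : a ∈ A) (hb : b ∈ B) (hab : l a ≠ l b)
    (hacta : ActiveLabel P l (l a)) (hactb : ActiveLabel P l (l b)) :
    IsGrouping (mergeClusters P A B) σ (fun x => if l x = l b then l a else l x)
      (fun i => if i = l a then size (l a) + size (l b) else if i = l b then 0 else size i)
      (fun i => if i = l a then weight (l a) + weight (l b)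
        else if i = l b then 0 else weight i) := by
  have hsum : ∀ f : ι → ℝ, ∑ i, (if i = l a then f (l a) + f (l b)
      else if i = l b then 0 else f i) = ∑ i, f i := by
    intro f
    have : ∀ i, (if i = l a then f (l a) + f (l b) else if i = l b then 0 else f i)
        = f i + ((if i = l a then f (l b) else 0) - (if i = l b then f (l b) else 0)) := by
      intro i
      by_cases h1 : i = l a
      · simp [h1, hab]
      · by_cases h2 : i = l b
        · simp [h2, hab.symm]
        · simp [h1, h2]
    simp [this, sum_add_distrib]
  have hmerge : ∀ x y, (if l x = l b then l a else l x) = l a →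
      (if l y = l b then l a else l y) = l a →
      dist x y ≤ (size (l a) + size (l b)) ^ linkExp * (weight (l a) + weight (l b)) := by
    obtain ⟨a', ha', b', hb', hd⟩ := exists_le_avgD dist ⟨a, ha⟩ ⟨b, hb⟩
    have hg := link_growth (h.size_nonneg (l a)) (h.size_nonneg (l b)) (h.weight_nonneg (l a))
      (h.weight_nonneg (l b)) (h.avgD_le_of_active hmin hacta)
      (h.avgD_le_of_active hmin hactb)
    have hm := (dist_nonneg.trans hd : 0 ≤ avgD dist A B)
    have hla := h.const A hA a' ha' a ha
    have hlb := h.const B hB b' hb' b hb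
    have hpa := mul_nonneg (Real.rpow_nonneg (h.size_nonneg (l a)) linkExp)
      (h.weight_nonneg (l a))
    have hpb := mul_nonneg (Real.rpow_nonneg (h.size_nonneg (l b)) linkExp)
      (h.weight_nonneg (l b))
    have hcross : ∀ x y, l x = l a → l y = l b →
        dist x y ≤ (size (l a) + size (l b)) ^ linkExp * (weight (l a) + weight (l b)) := by
      intro x y hx hy
      have h1 := h.bound _ hacta x a' hx hla
      have h2 := h.bound _ hactb b' y hlb hy
      have h3 := dist_triangle4 x a' b' y
      linarith
    intro x y hx hy
    have hor : ∀ z, (if l z = l b then l a else l z) = l a → l z = l b ∨ l z = l a := by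
      intro z hz
      split_ifs at hz with h1
      · exact .inl h1
      · exact .inr hz
    rcases hor x hx with hx | hx <;> rcases hor y hy with hy | hy
    · have := h.bound _ hactb x y hx hy
      linarith
    · rw [dist_comm]
      exact hcross y x hy hx
    · exact hcross x y hx hy
    · have := h.bound _ hacta x y hx hy
      linarith
  refine ⟨fun i => ?_, fun i => ?_, (hsum size).trans_le h.sum_size,
    (hsum weight).trans_le h.sum_weight, ?_, ?_⟩
  · have := h.size_nonneg
    split_ifs
    exacts [add_nonneg (this _) (this _), le_rfl, this _]
  · have := h.weight_nonneg
    split_ifs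
    exacts [add_nonneg (this _) (this _), le_rfl, this _]
  · intro C hC x hx y hy
    rcases mem_mergeClusters.1 hC with rfl | ⟨hC, -, -⟩
    · have key : ∀ z ∈ A ∪ B, (if l z = l b then l a else l z) = l a := by
        intro z hz
        split_ifs with hzb
        · rfl
        · rcases mem_union.1 hz with hz | hz
          · exact h.const A hA z hz a ha
          · exact absurd (h.const B hB z hz b hb) hzb
      simp only [key x hx, key y hy]
    · simp only [h.const C hC x hx y hy]
  · intro i hi x y hx hy
    by_cases hia : i = l a
    · subst hia
      simpa using hmerge x y hx hy
    have hib : i ≠ l b := by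
      rintro rfl
      split_ifs at hx with h1
      · exact hab hx
      · exact h1 hx
    have hold : ∀ z, (if l z = l b then l a else l z) = i → l z = i := by
      intro z hz
      split_ifs at hz with h1
      · exact absurd hz.symm hia
      · exact hz
    obtain ⟨C, hC, C', hC', hne, ⟨u, hu, hui⟩, v, hv, hvi⟩ := hi
    have hi' : ActiveLabel P l i := ActiveLabel.of_merge hA hB
      ⟨C, hC, C', hC', hne, ⟨u, hu, hold u hui⟩, v, hv, hold v hvi⟩
    simpa [hia, hib] using h.bound i hi' x y (hold x hx) (hold y hy)

lemma exists_merge [DecidableEq X] (h : IsGrouping P σ l size weight) {m : ℕ}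
    (hP : IsClustering P m) {A B : Finset X} (hA : A ∈ P) (hB : B ∈ P)
    (hmin : ∀ A' ∈ P, ∀ B' ∈ P, A' ≠ B' → avgD dist A B ≤ avgD dist A' B') :
    ∃ (l' : X → ι) (size' weight' : ι → ℝ),
      IsGrouping (mergeClusters P A B) σ l' size' weight' := by
  obtain ⟨a, ha⟩ := hP.2.1 A hA
  obtain ⟨b, hb⟩ := hP.2.1 B hB
  by_cases hab : l a = l b
  · exact ⟨_, _, _, h.merge_same hA hB ha hb hab⟩
  by_cases hactb : ActiveLabel P l (l b)
  · by_cases hacta : ActiveLabel P l (l a)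
    · exact ⟨_, _, _, h.merge_active hA hB hmin ha hb hab hacta hactb⟩
    · rw [mergeClusters_comm]
      exact ⟨_, _, _, h.merge_inactive hP hB hA ha hacta⟩
  · exact ⟨_, _, _, h.merge_inactive hP hA hB hb hactb⟩

end IsGrouping

/-! ### Logarithmic growth of the average distance to a point -/

lemma sum_dist_union_le {X : Type*} [MetricSpace X] [DecidableEq X] {A B : Finset X} {M : ℝ}
    (hB : B.Nonempty) (hAB : Disjoint A B) (hM : 0 ≤ M) (havg : avgD dist A B ≤ M)
    {x : X} (hx : x ∈ A) (hsum : ∑ z ∈ A, dist x z ≤ A.card * (M * Real.log A.card)) :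
    ∑ z ∈ A ∪ B, dist x z ≤ (A ∪ B).card * (M * Real.log (A ∪ B).card) := by
  have hA : A.Nonempty := ⟨x, hx⟩
  have ha : (0 : ℝ) < A.card := by exact_mod_cast hA.card_pos
  have hb : (0 : ℝ) < B.card := by exact_mod_cast hB.card_pos
  have htri : (A.card : ℝ) * ∑ z ∈ B, dist x z
      ≤ B.card * ∑ z ∈ A, dist x z + A.card * B.card * avgD dist A B := by
    rw [← sum_eq_card_mul_avgD dist hA hB]
    calc (A.card : ℝ) * ∑ z ∈ B, dist x z = ∑ a ∈ A, ∑ z ∈ B, dist x z := by simp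
      _ ≤ ∑ a ∈ A, ∑ z ∈ B, (dist x a + dist a z) :=
        sum_le_sum fun a _ => sum_le_sum fun z _ => dist_triangle x a z
      _ = B.card * ∑ z ∈ A, dist x z + ∑ a ∈ A, ∑ b ∈ B, dist a b := by
        simp [sum_add_distrib, mul_sum]
  rw [sum_union hAB, card_union_of_disjoint hAB]
  push_cast
  have hlog : (B.card : ℝ) ≤ (A.card + B.card) *
      (Real.log (A.card + B.card) - Real.log A.card) := by
    have := Real.one_sub_inv_le_log_of_pos (x := ((A.card : ℝ) + B.card) / A.card)
      (by positivity)
    rw [Real.log_div (by positivity) (by positivity), inv_div] at this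
    calc (B.card : ℝ) = (A.card + B.card) * (1 - A.card / (A.card + B.card)) := by
          field_simp; ring
      _ ≤ _ := by gcongr
  have hBsum : ∑ z ∈ B, dist x z ≤ B.card * (M * Real.log A.card) + B.card * M := by
    refine le_of_mul_le_mul_left ?_ ha
    calc (A.card : ℝ) * ∑ z ∈ B, dist x z
        ≤ B.card * (A.card * (M * Real.log A.card)) + A.card * B.card * M := by
          refine htri.trans ?_
          gcongr
      _ = _ := by ring
  nlinarith [mul_le_mul_of_nonneg_left hlog hM]

lemma dist_le_two_mul_log {X : Type*} [MetricSpace X] {C : Finset X} {M : ℝ}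
    (h : ∀ x ∈ C, ∑ z ∈ C, dist x z ≤ C.card * (M * Real.log C.card))
    {x y : X} (hx : x ∈ C) (hy : y ∈ C) : dist x y ≤ 2 * (M * Real.log C.card) := by
  have hc : (0 : ℝ) < C.card := by exact_mod_cast card_pos.2 ⟨x, hx⟩
  refine le_of_mul_le_mul_left ?_ hc
  calc (C.card : ℝ) * dist x y = ∑ z ∈ C, dist x y := by simp
    _ ≤ ∑ z ∈ C, (dist x z + dist y z) := sum_le_sum fun z _ => dist_triangle_right x y z
    _ ≤ _ := by
      rw [sum_add_distrib]
      linarith [h x hx, h y hy]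

/-! ### Paths through the target clusters -/

/-- The graph on target clusters joining clusters that contain points at distance at most
`M`. -/
def closeGraph {X : Type*} [MetricSpace X] (𝒞 : Finset (Finset X)) (M : ℝ) :
    SimpleGraph 𝒞 where
  Adj T T' := T ≠ T' ∧ ∃ a ∈ T.1, ∃ b ∈ T'.1, dist a b ≤ M
  symm := ⟨fun _ _ ⟨h, a, ha, b, hb, hd⟩ => ⟨h.symm, b, hb, a, ha, by rwa [dist_comm]⟩⟩
  loopless := ⟨fun _ h => h.1 rfl⟩

lemma dist_le_of_walk {X : Type*} [MetricSpace X] {𝒞 : Finset (Finset X)} {M : ℝ} {T T' : 𝒞}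
    (w : (closeGraph 𝒞 M).Walk T T') {x y : X} (hx : x ∈ T.1) (hy : y ∈ T'.1) :
    dist x y ≤ (w.support.map fun C => diamF dist C.1).sum + w.length * M := by
  induction w generalizing x with
  | nil => simpa using dist_le_diamF hx hy
  | cons hadj w ih =>
    have hadj' := hadj
    obtain ⟨-, a, ha, b, hb, hd⟩ := hadj'
    have h1 := dist_le_diamF hx ha
    have h2 := ih hb hy
    have h3 := dist_triangle4 x a b y
    simp only [SimpleGraph.Walk.support_cons, List.map_cons, List.sum_cons,
      SimpleGraph.Walk.length_cons]
    push_cast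
    linarith

lemma dist_le_of_reachable {X : Type*} [MetricSpace X] {𝒞 : Finset (Finset X)} {M : ℝ}
    (hM : 0 ≤ M) {T T' : 𝒞} (h : (closeGraph 𝒞 M).Reachable T T') {x y : X}
    (hx : x ∈ T.1) (hy : y ∈ T'.1) :
    dist x y ≤ ∑ C ∈ 𝒞, diamF dist C + (𝒞.card - 1) * M := by
  classical
  obtain ⟨w, hw⟩ := h.exists_isPath
  refine (dist_le_of_walk w hx hy).trans (add_le_add ?_ ?_)
  · rw [← List.sum_toFinset _ hw.support_nodup, ← sum_coe_sort 𝒞]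
    exact sum_le_sum_of_subset_of_nonneg (subset_univ _) fun C _ _ => diamF_nonneg C.1
  · have := hw.length_lt
    rw [Fintype.card_coe] at this
    have h' : (w.length : ℝ) + 1 ≤ 𝒞.card := by exact_mod_cast this
    gcongr
    linarith

/-! ### The invariant of an execution -/

/-- The bound on merge distances relative to a target clustering. -/
noncomputable def linkBound {X : Type*} [MetricSpace X] (𝒞 : Finset (Finset X)) : ℝ :=
  (𝒞.card : ℝ) ^ linkExp * ∑ C ∈ 𝒞, diamF dist C

lemma linkBound_nonneg {X : Type*} [MetricSpace X] (𝒞 : Finset (Finset X)) :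
    0 ≤ linkBound 𝒞 :=
  mul_nonneg (by positivity) (sum_nonneg fun C _ => diamF_nonneg C)

lemma rpow_logb_mul_avgDiam {X : Type*} [MetricSpace X] {𝒞 : Finset (Finset X)}
    (h : 0 < 𝒞.card) : (𝒞.card : ℝ) ^ Real.logb 2 3 * avgDiam dist 𝒞 = linkBound 𝒞 := by
  have h' : (0 : ℝ) < 𝒞.card := by exact_mod_cast h
  rw [linkBound, avgDiam, linkExp, Real.rpow_sub h', Real.rpow_one]
  ring

/-- What is maintained along an execution relative to a target clustering `𝒞`, where `τ`
sends each point to its target cluster. -/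
structure LinkInvariant {X : Type*} [MetricSpace X] (𝒞 : Finset (Finset X)) (τ : X → 𝒞)
    (P : Finset (Finset X)) : Prop where
  grouping : ∃ (l : X → 𝒞) (size weight : 𝒞 → ℝ),
    IsGrouping P (∑ C ∈ 𝒞, diamF dist C) l size weight
  sum_dist_le : ∀ C ∈ P, ∀ x ∈ C,
    ∑ z ∈ C, dist x z ≤ C.card * (linkBound 𝒞 * Real.log C.card)
  reachable : ∀ C ∈ P, ∀ x ∈ C, ∀ y ∈ C,
    (closeGraph 𝒞 (linkBound 𝒞)).Reachable (τ x) (τ y)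

lemma linkInvariant_singletons {X : Type*} [MetricSpace X] [Fintype X] [DecidableEq X]
    {𝒞 : Finset (Finset X)} {τ : X → 𝒞} (hτ : ∀ x, x ∈ (τ x).1) :
    LinkInvariant 𝒞 τ (univ.image fun x : X => ({x} : Finset X)) where
  grouping := by
    refine ⟨τ, fun _ => 1, fun C => diamF dist C.1, fun _ => zero_le_one,
      fun C => diamF_nonneg C.1, by simp, (sum_coe_sort 𝒞 (diamF dist)).le, ?_, ?_⟩
    · simp
    · rintro i - x y rfl hy
      rw [Real.one_rpow, one_mul]
      exact dist_le_diamF (hτ x) (hy ▸ hτ y)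
  sum_dist_le := by simp
  reachable := by simp

lemma LinkInvariant.merge {X : Type*} [MetricSpace X] [DecidableEq X]
    {𝒞 : Finset (Finset X)} {τ : X → 𝒞} (hτ : ∀ x, x ∈ (τ x).1) {P : Finset (Finset X)} {m : ℕ}
    (hP : IsClustering P m) (hm : 𝒞.card < m) (h : LinkInvariant 𝒞 τ P) {A B : Finset X}
    (hA : A ∈ P) (hB : B ∈ P) (hAB : A ≠ B)
    (hmin : ∀ A' ∈ P, ∀ B' ∈ P, A' ≠ B' → avgD dist A B ≤ avgD dist A' B') :
    LinkInvariant 𝒞 τ (mergeClusters P A B) := by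
  obtain ⟨l, size, weight, hg⟩ := h.grouping
  have havg : avgD dist A B ≤ linkBound 𝒞 := by
    obtain ⟨i, hi⟩ := hP.exists_activeLabel (by rwa [Fintype.card_coe]) l
    have := (hg.avgD_le_of_active hmin hi).trans (hg.bound_le i)
    rwa [Fintype.card_coe] at this
  have hdisj := hP.2.2.1 A hA B hB hAB
  have hAne := hP.2.1 A hA
  have hBne := hP.2.1 B hB
  refine ⟨hg.exists_merge hP hA hB hmin, ?_, ?_⟩
  · intro C hC x hx
    rcases mem_mergeClusters.1 hC with rfl | ⟨hC, -, -⟩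
    · rcases mem_union.1 hx with hx | hx
      · exact sum_dist_union_le hBne hdisj (linkBound_nonneg 𝒞) havg hx
          (h.sum_dist_le A hA x hx)
      · have havg' : avgD dist B A ≤ linkBound 𝒞 := by
          have hcomm : avgD dist B A = avgD dist A B := by
            unfold avgD
            rw [sum_comm, mul_comm]
            simp only [dist_comm]
          rwa [hcomm]
        rw [union_comm]
        exact sum_dist_union_le hAne hdisj.symm (linkBound_nonneg 𝒞) havg' hx
          (h.sum_dist_le B hB x hx)
    · exact h.sum_dist_le C hC x hx
  · intro C hC x hx y hy
    rcases mem_mergeClusters.1 hC with rfl | ⟨hC, -, -⟩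
    · obtain ⟨a, ha, b, hb, hd⟩ := exists_le_avgD dist hAne hBne
      have hlink : (closeGraph 𝒞 (linkBound 𝒞)).Reachable (τ a) (τ b) := by
        by_cases hab : τ a = τ b
        · rw [hab]
        · exact SimpleGraph.Adj.reachable ⟨hab, a, hτ a, b, hτ b, hd.trans havg⟩
      have key : ∀ z ∈ A ∪ B, (closeGraph 𝒞 (linkBound 𝒞)).Reachable (τ a) (τ z) := by
        intro z hz
        rcases mem_union.1 hz with hz | hz
        · exact h.reachable A hA a ha z hz
        · exact hlink.trans (h.reachable B hB b hb z hz)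
      exact (key x hx).symm.trans (key y hy)
    · exact h.reachable C hC x hx y hy

lemma AvgLinkExec.isClustering {X : Type*} [MetricSpace X] [Fintype X] [DecidableEq X]
    (E : AvgLinkExec X dist) {k : ℕ} (hk : 1 ≤ k) (hkn : k ≤ Fintype.card X) :
    IsClustering (E.part k) k := by
  induction hkn using Nat.decreasingInduction with
  | self => rw [E.init]; exact isClustering_singletons X
  | of_succ j hj ih =>
    obtain ⟨A, hA, B, hB, hAB, -, hpart⟩ := E.merge j hk hj
    rw [hpart]
    exact (ih (by omega)).mergeClusters hA hB hAB

lemma AvgLinkExec.linkInvariant {X : Type*} [MetricSpace X] [Fintype X] [DecidableEq X]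
    (E : AvgLinkExec X dist) {𝒞 : Finset (Finset X)} {τ : X → 𝒞} (hτ : ∀ x, x ∈ (τ x).1)
    {k : ℕ} (hk : 1 ≤ k) (hkn : k ≤ Fintype.card X) (hcard : 𝒞.card ≤ k) :
    LinkInvariant 𝒞 τ (E.part k) := by
  induction hkn using Nat.decreasingInduction with
  | self => rw [E.init]; exact linkInvariant_singletons hτ
  | of_succ j hj ih =>
    obtain ⟨A, hA, B, hB, hAB, hmin, hpart⟩ := E.merge j hk hj
    rw [hpart]
    exact (ih (by omega) (by omega)).merge hτ (E.isClustering (by omega) hj) (by omega)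
      hA hB hAB hmin

/-- The diameter bound relative to an arbitrary target clustering. -/
lemma AvgLinkExec.diamF_le_mul_linkBound {X : Type*} [MetricSpace X] [Fintype X]
    [DecidableEq X] (E : AvgLinkExec X dist) {k : ℕ} (hk : 1 ≤ k) (hkn : k ≤ Fintype.card X)
    {S : Finset X} (hS : S ∈ E.part k) {𝒞 : Finset (Finset X)} (h𝒞 : IsClustering 𝒞 k) :
    diamF dist S ≤ min (k : ℝ) (1 + 4 * Real.log (Fintype.card X)) * linkBound 𝒞 := by
  choose t ht hxt using h𝒞.2.2.2
  have hinv := E.linkInvariant (τ := fun x => ⟨t x, ht x⟩) hxt hk hkn h𝒞.1.le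
  have hM := linkBound_nonneg 𝒞
  have hk' : (1 : ℝ) ≤ k := by exact_mod_cast hk
  refine diamF_le ((E.isClustering hk hkn).2.1 S hS) fun x hx y hy => ?_
  rw [min_mul_of_nonneg _ _ hM, le_min_iff]
  constructor
  · have h1 := dist_le_of_reachable hM (hinv.reachable S hS x hx y hy) (hxt x) (hxt y)
    have h2 : ∑ C ∈ 𝒞, diamF dist C ≤ linkBound 𝒞 := by
      rw [linkBound, h𝒞.1]
      exact le_mul_of_one_le_left (sum_nonneg fun C _ => diamF_nonneg C)
        (Real.one_le_rpow hk' linkExp_pos.le)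
    rw [h𝒞.1] at h1
    linarith
  · have h1 := dist_le_two_mul_log (hinv.sum_dist_le S hS) hx hy
    have hS0 : (0 : ℝ) < S.card := by exact_mod_cast card_pos.2 ⟨x, hx⟩
    have h2 : Real.log S.card ≤ Real.log (Fintype.card X) :=
      Real.log_le_log hS0 (by exact_mod_cast card_le_univ S)
    have h3 : 0 ≤ Real.log (Fintype.card X) := Real.log_natCast_nonneg _
    nlinarith [mul_le_mul_of_nonneg_left h2 hM, mul_nonneg hM h3]

/-- Diameter bound for average-link: for every `2 ≤ k ≤ n` and every execution of
average-link on a finite metric space with `n` points, every cluster `S` of the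
`k`-clustering `A^k` satisfies
`diam(S) ≤ min{k, 1 + 4·ln n} · k^(log₂ 3) · OPT_AV(k)`. -/
theorem avgLink_diam_upper_bound {X : Type*} [MetricSpace X] [Fintype X] [DecidableEq X]
    (E : AvgLinkExec X dist) (k : ℕ) (hk2 : 2 ≤ k) (hkn : k ≤ Fintype.card X)
    (S : Finset X) (hS : S ∈ E.part k) :
    diamF dist S
      ≤ min (k : ℝ) (1 + 4 * Real.log (Fintype.card X))
          * (k : ℝ) ^ (Real.logb 2 3)
          * sInf {r : ℝ | ∃ 𝒞 : Finset (Finset X), IsClustering 𝒞 k ∧ r = avgDiam dist 𝒞} := by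
  have hk : 1 ≤ k := by omega
  have hk0 : (0 : ℝ) < k := by exact_mod_cast hk
  have hlog : 0 ≤ Real.log (Fintype.card X) := Real.log_natCast_nonneg _
  have hc : 0 < min (k : ℝ) (1 + 4 * Real.log (Fintype.card X)) * (k : ℝ) ^ Real.logb 2 3 :=
    mul_pos (lt_min hk0 (by linarith)) (Real.rpow_pos_of_pos hk0 _)
  rw [← div_le_iff₀' hc]
  refine le_csInf ⟨_, E.part k, E.isClustering hk hkn, rfl⟩ ?_
  rintro r ⟨𝒞, h𝒞, rfl⟩
  have hcard := h𝒞.1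
  rw [div_le_iff₀' hc, mul_assoc, ← hcard, rpow_logb_mul_avgDiam (by omega), hcard]
  exact E.diamF_le_mul_linkBound hk hkn hS h𝒞
end

section
/- Lower bound on the maximum diameter of average-link: there exists a constant c > 0 such that for every sufficiently large k there exist a finite metric space and an execution of average-link whose k-clustering A^k satisfies max-diam(A^k) ≥ c · k · OPT_DM(k). -/
open Finset

/-- `max-diam(𝒞) = max_{C ∈ 𝒞} diam(C)`. -/
noncomputable def maxDiam {X : Type*} (d : X → X → ℝ) (𝒞 : Finset (Finset X)) : ℝ :=
  sSup {r : ℝ | ∃ C ∈ 𝒞, r = diamF d C}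

/-- On the metric space `X`: some execution of average-link has a `k`-clustering whose
maximum diameter is at least `c · k · OPT_DM(k)`, where `OPT_DM(k)` is the minimum of
`max-diam` over all `k`-clusterings of `X`. -/
def BadForAvgLink (c : ℝ) (k : ℕ) (X : Type) [MetricSpace X] [Fintype X] [DecidableEq X] :
    Prop :=
  ∃ E : AvgLinkExec X dist,
    c * (k : ℝ) *
        sInf {r : ℝ | ∃ 𝒞 : Finset (Finset X), IsClustering 𝒞 k ∧ r = maxDiam dist 𝒞}
      ≤ maxDiam dist (E.part k)

/-! ### Executions and clusterings -/

/-- `Q` is obtained from `P` by one greedy merge of average-link. -/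
def AvgLinkStep {X : Type*} [DecidableEq X] (d : X → X → ℝ) (P Q : Finset (Finset X)) : Prop :=
  ∃ A ∈ P, ∃ B ∈ P, A ≠ B ∧
    (∀ A' ∈ P, ∀ B' ∈ P, A' ≠ B' → avgD d A B ≤ avgD d A' B') ∧
    Q = insert (A ∪ B) ((P.erase A).erase B)

/-- If every partition satisfying an invariant has a greedy merge preserving it, then some
execution of average-link satisfies the invariant throughout. -/
lemma exists_avgLinkExec_of_invariant {X : Type*} [Fintype X] [DecidableEq X] (d : X → X → ℝ)
    (I : ℕ → Finset (Finset X) → Prop)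
    (hinit : I (Fintype.card X) (univ.image fun x : X => ({x} : Finset X)))
    (hstep : ∀ j P, 1 ≤ j → j < Fintype.card X → I (j + 1) P →
      ∃ Q, AvgLinkStep d P Q ∧ I j Q) :
    ∃ E : AvgLinkExec X d, ∀ j, 1 ≤ j → j ≤ Fintype.card X → I j (E.part j) := by
  classical
  choose! next hnext using hstep
  let g : ℕ → Finset (Finset X) := fun t =>
    Nat.rec (univ.image fun x : X => ({x} : Finset X))
      (fun t P => next (Fintype.card X - (t + 1)) P) t
  have hg : ∀ t, t < Fintype.card X → I (Fintype.card X - t) (g t) := by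
    intro t
    induction t with
    | zero => intro _; exact hinit
    | succ t ih =>
      intro ht
      have h := ih (by omega)
      rw [show Fintype.card X - t = Fintype.card X - (t + 1) + 1 by omega] at h
      exact (hnext _ _ (by omega) (by omega) h).2
  refine ⟨⟨fun j => g (Fintype.card X - j), ?_, ?_⟩, ?_⟩
  · simp [g]
  · intro j h1 h2
    have h := hg (Fintype.card X - (j + 1)) (by omega)
    rw [show Fintype.card X - (Fintype.card X - (j + 1)) = j + 1 by omega] at h
    have h' := (hnext _ _ h1 h2 h).1
    have e : g (Fintype.card X - j) = next j (g (Fintype.card X - (j + 1))) := by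
      rw [show Fintype.card X - j = (Fintype.card X - (j + 1)) + 1 by omega]
      change next (Fintype.card X - (Fintype.card X - (j + 1) + 1)) _ = _
      rw [show Fintype.card X - (Fintype.card X - (j + 1) + 1) = j by omega]
    simp only [e]
    exact h'
  · intro j h1 h2
    have h := hg (Fintype.card X - j) (by omega)
    rwa [show Fintype.card X - (Fintype.card X - j) = j by omega] at h

lemma IsClustering.merge {X : Type*} [DecidableEq X] {P : Finset (Finset X)} {j : ℕ}
    (h : IsClustering P (j + 1)) {A B : Finset X} (hA : A ∈ P) (hB : B ∈ P) (hAB : A ≠ B) :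
    IsClustering (insert (A ∪ B) ((P.erase A).erase B)) j := by
  obtain ⟨hc, hne, hd, hcov⟩ := h
  have hdis : ∀ C ∈ (P.erase A).erase B, Disjoint (A ∪ B) C := by
    intro C hC
    simp only [mem_erase] at hC
    rw [disjoint_union_left]
    exact ⟨hd A hA C hC.2.2 (Ne.symm hC.2.1), hd B hB C hC.2.2 (Ne.symm hC.1)⟩
  have hABne : (A ∪ B).Nonempty := (hne A hA).mono subset_union_left
  refine ⟨?_, ?_, ?_, ?_⟩
  · rw [card_insert_of_notMem, card_erase_of_mem, card_erase_of_mem hA, hc]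
    · have : 1 < P.card := one_lt_card.2 ⟨A, hA, B, hB, hAB⟩
      omega
    · exact mem_erase.2 ⟨hAB.symm, hB⟩
    · intro hmem
      exact hABne.ne_empty (disjoint_self.1 (hdis _ hmem))
  · intro C hC
    rcases mem_insert.1 hC with rfl | hC
    · exact hABne
    · exact hne C (mem_of_mem_erase (mem_of_mem_erase hC))
  · intro C hC C' hC' hCC'
    rcases mem_insert.1 hC with rfl | hC <;> rcases mem_insert.1 hC' with rfl | hC'
    · exact absurd rfl hCC'
    · exact hdis _ hC'
    · exact (hdis _ hC).symm
    · exact hd C (mem_of_mem_erase (mem_of_mem_erase hC)) C'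
        (mem_of_mem_erase (mem_of_mem_erase hC')) hCC'
  · intro x
    obtain ⟨C, hC, hx⟩ := hcov x
    by_cases hCA : C = A
    · exact ⟨A ∪ B, mem_insert_self _ _, mem_union_left _ (hCA ▸ hx)⟩
    by_cases hCB : C = B
    · exact ⟨A ∪ B, mem_insert_self _ _, mem_union_right _ (hCB ▸ hx)⟩
    · exact ⟨C, mem_insert_of_mem (mem_erase.2 ⟨hCB, mem_erase.2 ⟨hCA, hC⟩⟩), hx⟩

lemma avgD_comm {X : Type*} [MetricSpace X] (A B : Finset X) :
    avgD dist A B = avgD dist B A := by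
  unfold avgD
  rw [sum_comm, mul_comm]
  simp only [dist_comm]

lemma dist_le_maxDiam {X : Type*} [MetricSpace X] {P : Finset (Finset X)} {C : Finset X}
    (hC : C ∈ P) {x y : X} (hx : x ∈ C) (hy : y ∈ C) : dist x y ≤ maxDiam dist P := by
  have h₁ : dist x y ≤ diamF dist C := by
    refine le_csSup (Set.Finite.bddAbove ?_) ⟨x, hx, y, hy, rfl⟩
    refine ((C ×ˢ C).finite_toSet.image fun p => dist p.1 p.2).subset ?_
    rintro _ ⟨a, ha, b, hb, rfl⟩
    exact ⟨(a, b), by simp [ha, hb], rfl⟩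
  refine h₁.trans (le_csSup (Set.Finite.bddAbove ?_) ⟨C, hC, rfl⟩)
  refine (P.finite_toSet.image (diamF dist)).subset ?_
  rintro _ ⟨D, hD, rfl⟩
  exact ⟨D, hD, rfl⟩

lemma maxDiam_le {X : Type*} [MetricSpace X] {P : Finset (Finset X)} {r : ℝ} (hr : 0 ≤ r)
    (h : ∀ C ∈ P, ∀ x ∈ C, ∀ y ∈ C, dist x y ≤ r) : maxDiam dist P ≤ r := by
  refine Real.sSup_le ?_ hr
  rintro _ ⟨C, hC, rfl⟩
  refine Real.sSup_le ?_ hr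
  rintro _ ⟨x, hx, y, hy, rfl⟩
  exact h C hC x hx y hy

lemma maxDiam_nonneg {X : Type*} [MetricSpace X] (P : Finset (Finset X)) :
    0 ≤ maxDiam dist P := by
  refine Real.sSup_nonneg ?_
  rintro _ ⟨C, -, rfl⟩
  refine Real.sSup_nonneg ?_
  rintro _ ⟨x, -, y, -, rfl⟩
  exact dist_nonneg

/-! ### The metric space

There are `2 * k` groups of points, the `i`-th one with `(12 * k) ^ i` points at position
`i * (k + i)` of the real line; the distance of two distinct points is one more than the distance
of their positions. The gaps between consecutive groups increase slowly, while the group sizes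
grow so fast that the union of the first groups behaves almost like its last group. So
average-link first forms the groups and then absorbs them from left to right into one cluster. -/

/-- The points: `⟨i, a⟩` is the `a`-th point of the `i`-th group. -/
def GroupedPoint (k : ℕ) : Type := Σ i : Fin (2 * k), Fin ((12 * k) ^ (i : ℕ))

namespace GroupedPoint

variable {k : ℕ}

instance : Fintype (GroupedPoint k) :=
  inferInstanceAs (Fintype (Σ i : Fin (2 * k), Fin ((12 * k) ^ (i : ℕ))))

instance : DecidableEq (GroupedPoint k) :=
  inferInstanceAs (DecidableEq (Σ i : Fin (2 * k), Fin ((12 * k) ^ (i : ℕ))))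

/-- The index of the group of a point. -/
def grp (x : GroupedPoint k) : ℕ := x.1

lemma grp_lt (x : GroupedPoint k) : x.grp < 2 * k := x.1.isLt

/-- The position of the `i`-th group. -/
def pos (k i : ℕ) : ℝ := i * (k + i)

lemma pos_mono {i j : ℕ} (h : i ≤ j) : pos k i ≤ pos k j := by
  unfold pos
  gcongr

lemma pos_succ (i : ℕ) : pos k (i + 1) = pos k i + (k + 2 * i + 1) := by
  unfold pos
  push_cast
  ring

noncomputable instance : MetricSpace (GroupedPoint k) where
  dist x y := if x = y then 0 else 1 + |pos k x.grp - pos k y.grp|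
  dist_self x := by simp
  dist_comm x y := by simp only [eq_comm, abs_sub_comm]
  dist_triangle x y z := by
    have h := abs_sub_le (pos k x.grp) (pos k y.grp) (pos k z.grp)
    have h₁ := abs_nonneg (pos k x.grp - pos k y.grp)
    have h₂ := abs_nonneg (pos k y.grp - pos k z.grp)
    by_cases hxy : x = y
    · simp [hxy]
    by_cases hyz : y = z
    · simp [hyz]
    simp only [hxy, hyz, if_false]
    split_ifs <;> linarith
  eq_of_dist_eq_zero {x y} h := by
    by_contra hxy
    change (if x = y then (0 : ℝ) else 1 + |pos k x.grp - pos k y.grp|) = 0 at h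
    rw [if_neg hxy] at h
    linarith [abs_nonneg (pos k x.grp - pos k y.grp)]

lemma dist_of_ne {x y : GroupedPoint k} (h : x ≠ y) :
    dist x y = 1 + |pos k x.grp - pos k y.grp| := if_neg h

lemma dist_le (x y : GroupedPoint k) : dist x y ≤ 1 + |pos k x.grp - pos k y.grp| := by
  by_cases h : x = y
  · rw [h, dist_self]
    positivity
  · exact (dist_of_ne h).le

/-- The `i`-th group. -/
def group (k i : ℕ) : Finset (GroupedPoint k) := univ.filter fun x => x.grp = i

/-- The union of the groups up to the `i`-th one. -/
def initial (k i : ℕ) : Finset (GroupedPoint k) := univ.filter fun x => x.grp ≤ i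

@[simp] lemma mem_group {i : ℕ} {x : GroupedPoint k} : x ∈ group k i ↔ x.grp = i := by
  simp [group]

@[simp] lemma mem_initial {i : ℕ} {x : GroupedPoint k} : x ∈ initial k i ↔ x.grp ≤ i := by
  simp [initial]

lemma initial_zero : initial k 0 = group k 0 := by
  ext x
  simp

lemma initial_succ (i : ℕ) : initial k (i + 1) = initial k i ∪ group k (i + 1) := by
  ext x
  simp only [mem_initial, mem_union, mem_group]
  omega

lemma disjoint_initial_group {i j : ℕ} (h : i < j) : Disjoint (initial k i) (group k j) := by
  rw [Finset.disjoint_left]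
  intro x hx hx'
  rw [mem_initial] at hx
  rw [mem_group] at hx'
  omega

/-- The `a`-th point of the `i`-th group. -/
def mk {i : ℕ} (hi : i < 2 * k) (a : Fin ((12 * k) ^ i)) : GroupedPoint k := ⟨⟨i, hi⟩, a⟩

lemma mk_injective {i : ℕ} (hi : i < 2 * k) : Function.Injective (mk hi) :=
  fun _ _ h => eq_of_heq (Sigma.mk.inj h).2

lemma exists_mk_eq (x : GroupedPoint k) : ∃ a, mk x.grp_lt a = x := ⟨x.2, rfl⟩

lemma card_group {i : ℕ} (hi : i < 2 * k) : (group k i).card = (12 * k) ^ i := by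
  have : group k i = univ.image (mk hi) := by
    ext x
    simp only [mem_group, mem_image, mem_univ, true_and]
    constructor
    · rintro rfl
      exact exists_mk_eq x
    · rintro ⟨a, rfl⟩
      rfl
  rw [this, card_image_of_injective _ (mk_injective hi), card_univ, Fintype.card_fin]

lemma group_nonempty {i : ℕ} (hi : i < 2 * k) : (group k i).Nonempty := by
  rw [← card_pos, card_group hi]
  exact pow_pos (by omega) _

lemma exists_grp_eq {i : ℕ} (hi : i < 2 * k) : ∃ x : GroupedPoint k, x.grp = i := by
  obtain ⟨x, hx⟩ := group_nonempty hi
  exact ⟨x, mem_group.1 hx⟩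

lemma initial_nonempty (hk : 0 < k) (i : ℕ) : (initial k i).Nonempty := by
  obtain ⟨x, hx⟩ := exists_grp_eq (k := k) (i := 0) (by omega)
  exact ⟨x, by simp [hx]⟩

lemma card_initial_le {i : ℕ} (hi : i < 2 * k) : (initial k i).card ≤ 2 * (12 * k) ^ i := by
  induction i with
  | zero =>
    rw [initial_zero, card_group hi]
    omega
  | succ i ih =>
    rw [initial_succ, card_union_of_disjoint (disjoint_initial_group (Nat.lt_succ_self i)),
      card_group hi]
    have h := ih (by omega)
    have : 2 * (12 * k) ^ i ≤ (12 * k) ^ (i + 1) := by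
      rw [pow_succ, mul_comm]
      exact Nat.mul_le_mul_left _ (by omega)
    omega

/-- The initial cluster is concentrated at its last group. -/
lemma sum_initial_pos_sub_le {i : ℕ} (hi : i < 2 * k) :
    ∑ x ∈ initial k i, (pos k i - pos k x.grp) ≤ (initial k i).card := by
  induction i with
  | zero =>
    rw [sum_eq_zero]
    · positivity
    · intro x hx
      rw [mem_initial, Nat.le_zero] at hx
      rw [hx, sub_self]
  | succ i ih =>
    have hdis := disjoint_initial_group (k := k) (Nat.lt_succ_self i)
    rw [initial_succ, sum_union hdis, card_union_of_disjoint hdis, card_group hi]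
    have h₀ : ∑ x ∈ group k (i + 1), (pos k (i + 1) - pos k x.grp) = 0 :=
      sum_eq_zero fun x hx => by rw [mem_group.1 hx, sub_self]
    have h₁ : ∑ x ∈ initial k i, (pos k (i + 1) - pos k x.grp)
        = ∑ x ∈ initial k i, (pos k i - pos k x.grp)
          + (initial k i).card * (k + 2 * i + 1) := by
      rw [← nsmul_eq_mul, ← sum_const, ← sum_add_distrib]
      refine sum_congr rfl fun x _ => ?_
      rw [pos_succ]
      ring
    have h₂ : (initial k i).card * (k + 2 * i + 1) ≤ (12 * k) ^ (i + 1) := by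
      calc (initial k i).card * (k + 2 * i + 1)
          ≤ (2 * (12 * k) ^ i) * (6 * k) :=
            Nat.mul_le_mul (card_initial_le (by omega)) (by omega)
        _ = (12 * k) ^ (i + 1) := by ring
    have h₃ : ((initial k i).card : ℝ) * (k + 2 * i + 1) ≤ ((12 * k) ^ (i + 1) : ℕ) := by
      exact_mod_cast h₂
    have h₄ := ih (by omega)
    rw [h₀, h₁]
    push_cast at h₃ ⊢
    linarith

/-! ### Average distances -/

lemma one_le_avgD {A B : Finset (GroupedPoint k)} (hA : A.Nonempty) (hB : B.Nonempty)
    (h : Disjoint A B) : 1 ≤ avgD dist A B := by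
  have hA' : (0 : ℝ) < A.card := by exact_mod_cast hA.card_pos
  have hB' : (0 : ℝ) < B.card := by exact_mod_cast hB.card_pos
  unfold avgD
  rw [le_div_iff₀ (by positivity), one_mul]
  calc (A.card : ℝ) * B.card = ∑ a ∈ A, ∑ b ∈ B, (1 : ℝ) := by simp
    _ ≤ _ := by
      refine sum_le_sum fun a ha => sum_le_sum fun b hb => ?_
      rw [dist_of_ne (disjoint_iff_ne.1 h a ha b hb)]
      linarith [abs_nonneg (pos k a.grp - pos k b.grp)]

lemma avgD_le_one {A B : Finset (GroupedPoint k)} (h : ∀ a ∈ A, ∀ b ∈ B, a.grp = b.grp) :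
    avgD dist A B ≤ 1 := by
  refine div_le_one_of_le₀ ?_ (by positivity)
  calc ∑ a ∈ A, ∑ b ∈ B, dist a b ≤ ∑ a ∈ A, ∑ b ∈ B, (1 : ℝ) := by
        refine sum_le_sum fun a ha => sum_le_sum fun b hb => (dist_le a b).trans ?_
        simp [h a ha b hb]
    _ = _ := by simp

lemma avgD_group {A : Finset (GroupedPoint k)} {j : ℕ} (hj : j < 2 * k)
    (h : ∀ x ∈ A, x.grp ≠ j) :
    avgD dist A (group k j) = (∑ x ∈ A, (1 + |pos k x.grp - pos k j|)) / A.card := by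
  have hB : ((group k j).card : ℝ) ≠ 0 := by exact_mod_cast (group_nonempty hj).card_pos.ne'
  have : ∑ x ∈ A, ∑ y ∈ group k j, dist x y
      = (∑ x ∈ A, (1 + |pos k x.grp - pos k j|)) * (group k j).card := by
    rw [sum_mul]
    refine sum_congr rfl fun x hx => ?_
    rw [mul_comm, ← nsmul_eq_mul, ← sum_const]
    refine sum_congr rfl fun y hy => ?_
    rw [mem_group] at hy
    rw [dist_of_ne, hy]
    rintro rfl
    exact h x hx hy
  unfold avgD
  rw [this, mul_div_mul_right _ _ hB]

lemma avgD_group_group {i j : ℕ} (hi : i < 2 * k) (hj : j < 2 * k) (hij : i ≠ j) :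
    avgD dist (group k i) (group k j) = 1 + |pos k i - pos k j| := by
  have hB : ((group k i).card : ℝ) ≠ 0 := by exact_mod_cast (group_nonempty hi).card_pos.ne'
  rw [avgD_group hj fun x hx => by rwa [mem_group.1 hx]]
  rw [sum_congr rfl fun x hx => by rw [mem_group.1 hx], sum_const, nsmul_eq_mul,
    mul_div_cancel_left₀ _ hB]

lemma avgD_initial_group {i j : ℕ} (hij : i < j) (hj : j < 2 * k) :
    avgD dist (initial k i) (group k j)
      = (∑ x ∈ initial k i, (1 + (pos k j - pos k x.grp))) / (initial k i).card := by
  rw [avgD_group hj fun x hx => by rw [mem_initial] at hx; omega]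
  congr 1
  refine sum_congr rfl fun x hx => ?_
  rw [mem_initial] at hx
  rw [abs_sub_comm, abs_of_nonneg (sub_nonneg.2 (pos_mono (by omega)))]

lemma avgD_initial_group_mono {i j : ℕ} (hij : i < j) (hj : j < 2 * k) :
    avgD dist (initial k i) (group k (i + 1)) ≤ avgD dist (initial k i) (group k j) := by
  rw [avgD_initial_group (Nat.lt_succ_self i) (by omega), avgD_initial_group hij hj]
  gcongr with x
  exact pos_mono hij

lemma avgD_initial_group_succ_le {i : ℕ} (hi : i + 1 < 2 * k) :
    avgD dist (initial k i) (group k (i + 1)) ≤ 1 + (pos k (i + 2) - pos k (i + 1)) := by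
  have hU : (0 : ℝ) < (initial k i).card := by
    exact_mod_cast (initial_nonempty (by omega) i).card_pos
  rw [avgD_initial_group (Nat.lt_succ_self i) hi, div_le_iff₀ hU]
  have h : ∑ x ∈ initial k i, (1 + (pos k (i + 1) - pos k x.grp))
      = ∑ x ∈ initial k i, (pos k i - pos k x.grp)
        + (initial k i).card * (1 + (k + 2 * i + 1)) := by
    rw [← nsmul_eq_mul, ← sum_const, ← sum_add_distrib]
    refine sum_congr rfl fun x _ => ?_
    rw [pos_succ]
    ring
  have h' := sum_initial_pos_sub_le (k := k) (i := i) (by omega)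
  rw [h, pos_succ (i + 1)]
  push_cast
  nlinarith

lemma avgD_initial_le_group_group {i a b : ℕ} (ha : i < a) (hab : a < b) (hb : b < 2 * k) :
    avgD dist (initial k i) (group k (i + 1)) ≤ avgD dist (group k a) (group k b) := by
  rw [avgD_group_group (by omega) hb hab.ne, abs_sub_comm,
    abs_of_nonneg (sub_nonneg.2 (pos_mono hab.le))]
  refine (avgD_initial_group_succ_le (by omega)).trans ?_
  have h₁ := pos_mono (k := k) (show a + 1 ≤ b from hab)
  have h₂ : (i : ℝ) + 1 ≤ a := by exact_mod_cast ha
  rw [pos_succ] at h₁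
  rw [pos_succ (i + 1)]
  push_cast
  linarith

/-! ### The execution -/

/-- The first groups up to the `i`-th one merged, the other ones separate. -/
def chain (k i : ℕ) : Finset (Finset (GroupedPoint k)) :=
  insert (initial k i) ((Ioo i (2 * k)).image (group k))

lemma group_ne_initial {i j : ℕ} (hij : i < j) (hj : j < 2 * k) : group k j ≠ initial k i := by
  intro h
  obtain ⟨x, hx⟩ := group_nonempty hj
  have hx' := hx
  rw [h, mem_initial] at hx'
  rw [mem_group] at hx
  omega

lemma group_inj {i j : ℕ} (hi : i < 2 * k) (h : group k i = group k j) : i = j := by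
  obtain ⟨x, hx⟩ := group_nonempty hi
  have hx' := hx
  rw [h, mem_group] at hx'
  rw [mem_group] at hx
  omega

lemma chain_succ (i : ℕ) :
    chain k (i + 1) = insert (initial k i ∪ group k (i + 1))
      (((chain k i).erase (initial k i)).erase (group k (i + 1))) := by
  rw [← initial_succ, chain, chain, erase_insert]
  · congr 1
    ext C
    simp only [mem_image, mem_erase, mem_Ioo]
    constructor
    · rintro ⟨j, hj, rfl⟩
      exact ⟨fun h => by have := group_inj hj.2 h; omega, j, by omega, rfl⟩
    · rintro ⟨hne, j, hj, rfl⟩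
      refine ⟨j, ⟨?_, hj.2⟩, rfl⟩
      rcases Nat.lt_or_ge (i + 1) j with h | h
      · exact h
      · exact absurd (by rw [show j = i + 1 by omega]) hne
  · simp only [mem_image, mem_Ioo, not_exists, not_and]
    exact fun j hj => group_ne_initial hj.1 hj.2

lemma avgLinkStep_chain {i : ℕ} (hi : i + 1 < 2 * k) :
    AvgLinkStep dist (chain k i) (chain k (i + 1)) := by
  refine ⟨initial k i, mem_insert_self _ _, group k (i + 1),
    mem_insert_of_mem (mem_image_of_mem _ (by simp [hi])),
    (group_ne_initial (Nat.lt_succ_self i) hi).symm, ?_, chain_succ i⟩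
  intro A hA B hB hAB
  simp only [chain, mem_insert, mem_image, mem_Ioo] at hA hB
  rcases hA with rfl | ⟨a, ha, rfl⟩ <;> rcases hB with rfl | ⟨b, hb, rfl⟩
  · exact absurd rfl hAB
  · exact avgD_initial_group_mono hb.1 hb.2
  · rw [avgD_comm (group k a)]
    exact avgD_initial_group_mono ha.1 ha.2
  · rcases lt_trichotomy a b with h | rfl | h
    · exact avgD_initial_le_group_group ha.1 h hb.2
    · exact absurd rfl hAB
    · rw [avgD_comm (group k a)]
      exact avgD_initial_le_group_group hb.1 h ha.2

/-- While there are more clusters than groups, a greedy merge can stay within a group. -/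
lemma exists_avgLinkStep_of_refines (hk : 0 < k) {P : Finset (Finset (GroupedPoint k))} {j : ℕ}
    (hj : 2 * k ≤ j) (hP : IsClustering P (j + 1))
    (hr : ∀ C ∈ P, ∀ x ∈ C, ∀ y ∈ C, x.grp = y.grp) :
    ∃ Q, AvgLinkStep dist P Q ∧ IsClustering Q j ∧
      ∀ C ∈ Q, ∀ x ∈ C, ∀ y ∈ C, x.grp = y.grp := by
  have hne := hP.2.1
  have : Nonempty (GroupedPoint k) := ⟨(exists_grp_eq (i := 0) (by omega)).choose⟩
  choose! rep hrep using hne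
  obtain ⟨A, hA, B, hB, hAB, hg⟩ := exists_ne_map_eq_of_card_lt_of_maps_to
    (s := P) (t := range (2 * k)) (f := fun C => (rep C).grp)
    (by rw [card_range, hP.1]; omega) (fun C _ => by simpa using grp_lt (rep C))
  have hsame : ∀ x ∈ A ∪ B, x.grp = (rep A).grp := by
    intro x hx
    rcases mem_union.1 hx with hx | hx
    · exact hr A hA x hx _ (hrep A hA)
    · exact (hr B hB x hx _ (hrep B hB)).trans hg.symm
  refine ⟨_, ⟨A, hA, B, hB, hAB, ?_, rfl⟩, hP.merge hA hB hAB, ?_⟩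
  · intro A' hA' B' hB' hAB'
    refine (avgD_le_one fun a ha b hb => ?_).trans
      (one_le_avgD (hP.2.1 A' hA') (hP.2.1 B' hB') (hP.2.2.1 A' hA' B' hB' hAB'))
    rw [hsame a (mem_union_left _ ha), hsame b (mem_union_right _ hb)]
  · intro C hC x hx y hy
    rcases mem_insert.1 hC with rfl | hC
    · rw [hsame x hx, hsame y hy]
    · exact hr C (mem_of_mem_erase (mem_of_mem_erase hC)) x hx y hy

/-- A clustering into `2 * k` clusters refining the groups consists of the groups. -/
lemma eq_chain_zero_of_refines (hk : 0 < k) {P : Finset (Finset (GroupedPoint k))}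
    (hP : IsClustering P (2 * k)) (hr : ∀ C ∈ P, ∀ x ∈ C, ∀ y ∈ C, x.grp = y.grp) :
    P = chain k 0 := by
  have hne := hP.2.1
  have : Nonempty (GroupedPoint k) := ⟨(exists_grp_eq (i := 0) (by omega)).choose⟩
  choose! rep hrep using hne
  have hinj : Set.InjOn (fun C => (rep C).grp) (P : Set (Finset (GroupedPoint k))) := by
    rw [← card_image_iff]
    refine le_antisymm card_image_le ?_
    rw [hP.1]
    calc 2 * k = (range (2 * k)).card := (card_range _).symm
      _ ≤ _ := card_le_card fun i hi => ?_
    obtain ⟨x, hx⟩ := exists_grp_eq (mem_range.1 hi)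
    obtain ⟨C, hC, hxC⟩ := hP.2.2.2 x
    exact mem_image.2 ⟨C, hC, (hr C hC _ (hrep C hC) x hxC).trans hx⟩
  have hgroup : ∀ C ∈ P, C = group k (rep C).grp := by
    intro C hC
    ext x
    rw [mem_group]
    refine ⟨fun hx => hr C hC x hx _ (hrep C hC), fun hx => ?_⟩
    obtain ⟨C', hC', hxC'⟩ := hP.2.2.2 x
    have : C' = C := hinj hC' hC ((hr C' hC' _ (hrep C' hC') x hxC').trans hx)
    exact this ▸ hxC'
  refine eq_of_subset_of_card_le (fun C hC => ?_) ?_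
  · rw [hgroup C hC]
    have hlt := grp_lt (rep C)
    rcases Nat.eq_zero_or_pos (rep C).grp with h | h
    · rw [h, ← initial_zero]
      exact mem_insert_self _ _
    · exact mem_insert_of_mem (mem_image_of_mem _ (mem_Ioo.2 ⟨h, hlt⟩))
  · rw [hP.1]
    have h₁ := card_insert_le (initial k 0) ((Ioo 0 (2 * k)).image (group k))
    have h₂ := card_image_le (s := Ioo 0 (2 * k)) (f := group k)
    rw [Nat.card_Ioo] at h₂
    unfold chain
    omega

lemma two_mul_le_card (k : ℕ) : 2 * k ≤ Fintype.card (GroupedPoint k) := by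
  have h : (range (2 * k)) ⊆ (univ : Finset (GroupedPoint k)).image grp := fun i hi => by
    obtain ⟨x, hx⟩ := exists_grp_eq (mem_range.1 hi)
    exact mem_image.2 ⟨x, mem_univ _, hx⟩
  simpa using (card_le_card h).trans card_image_le

lemma exists_avgLinkExec_chain (hk : 0 < k) :
    ∃ E : AvgLinkExec (GroupedPoint k) dist, E.part k = chain k k := by
  have hcard := two_mul_le_card k
  refine Exists.imp (fun E hE => ?_) (exists_avgLinkExec_of_invariant (X := GroupedPoint k) dist
    (fun j P => (2 * k ≤ j → IsClustering P j ∧ ∀ C ∈ P, ∀ x ∈ C, ∀ y ∈ C, x.grp = y.grp) ∧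
      (j ≤ 2 * k → P = chain k (2 * k - j))) ?_ ?_)
  · rw [(hE k hk (by omega)).2 (by omega), show 2 * k - k = k by omega]
  · have hr : ∀ C ∈ univ.image (fun x : GroupedPoint k => ({x} : Finset (GroupedPoint k))),
        ∀ x ∈ C, ∀ y ∈ C, x.grp = y.grp := by
      simp only [mem_image, mem_univ, true_and, forall_exists_index]
      rintro _ z rfl x hx y hy
      rw [mem_singleton.1 hx, mem_singleton.1 hy]
    refine ⟨fun _ => ⟨isClustering_singletons _, hr⟩, fun h => ?_⟩
    have hc : Fintype.card (GroupedPoint k) = 2 * k := le_antisymm h hcard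
    have hP := isClustering_singletons (GroupedPoint k)
    rw [hc] at hP ⊢
    rw [Nat.sub_self]
    exact eq_chain_zero_of_refines hk hP hr
  · rintro j P h1 - ⟨hfine, hcoarse⟩
    rcases Nat.lt_or_ge j (2 * k) with hj | hj
    · refine ⟨chain k (2 * k - j), ?_, fun h => absurd h (by omega), fun _ => rfl⟩
      rw [hcoarse hj, show 2 * k - j = 2 * k - (j + 1) + 1 by omega]
      exact avgLinkStep_chain (by omega)
    · obtain ⟨hP, hr⟩ := hfine (by omega)
      obtain ⟨Q, hstep, hQ, hrQ⟩ := exists_avgLinkStep_of_refines hk hj hP hr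
      refine ⟨Q, hstep, fun _ => ⟨hQ, hrQ⟩, fun h => ?_⟩
      obtain rfl : j = 2 * k := le_antisymm h hj
      rw [Nat.sub_self]
      exact eq_chain_zero_of_refines hk hQ hrQ

lemma le_maxDiam_chain (hk : 0 < k) : 2 * (k : ℝ) ^ 2 ≤ maxDiam dist (chain k k) := by
  obtain ⟨x, hx⟩ := exists_grp_eq (k := k) (i := 0) (by omega)
  obtain ⟨y, hy⟩ := exists_grp_eq (k := k) (i := k) (by omega)
  have hne : x ≠ y := by
    rintro rfl
    omega
  refine le_trans ?_ (dist_le_maxDiam (mem_insert_self _ _) (x := x) (y := y)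
    (by simp [hx]) (by simp [hy]))
  have h := neg_abs_le (pos k 0 - pos k k)
  rw [dist_of_ne hne, hx, hy]
  unfold pos at h ⊢
  push_cast at h ⊢
  nlinarith

/-! ### A good clustering -/

/-- The clustering that joins consecutive groups in pairs. -/
def pairing (k : ℕ) : Finset (Finset (GroupedPoint k)) :=
  (range k).image fun t => univ.filter fun x => x.grp / 2 = t

lemma isClustering_pairing (k : ℕ) : IsClustering (pairing k) k := by
  have hne : ∀ t < k, (univ.filter fun x : GroupedPoint k => x.grp / 2 = t).Nonempty := by
    intro t ht
    obtain ⟨x, hx⟩ := exists_grp_eq (k := k) (i := 2 * t) (by omega)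
    exact ⟨x, by simp [hx]⟩
  refine ⟨?_, ?_, ?_, fun x => ?_⟩
  · rw [pairing, card_image_of_injOn, card_range]
    intro s hs t _ hst
    obtain ⟨x, hx⟩ := hne s (by simpa using hs)
    have hx' := hx
    simp only at hst
    rw [hst, mem_filter] at hx'
    rw [mem_filter] at hx
    omega
  · simp only [pairing, mem_image, mem_range]
    rintro _ ⟨t, ht, rfl⟩
    exact hne t ht
  · simp only [pairing, mem_image, mem_range]
    rintro _ ⟨s, -, rfl⟩ _ ⟨t, -, rfl⟩ hst
    rw [Finset.disjoint_left]
    intro x hx hx'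
    rw [mem_filter] at hx hx'
    exact hst (by rw [← hx.2, ← hx'.2])
  · have := grp_lt x
    exact ⟨_, mem_image.2 ⟨x.grp / 2, mem_range.2 (by omega), rfl⟩, by simp⟩

lemma maxDiam_pairing_le (hk : 0 < k) : maxDiam dist (pairing k) ≤ 6 * k := by
  refine maxDiam_le (by positivity) ?_
  have hk' : (1 : ℝ) ≤ k := by exact_mod_cast hk
  have hle : ∀ x y : GroupedPoint k, x.grp ≤ y.grp → x.grp / 2 = y.grp / 2 →
      dist x y ≤ 6 * k := by
    intro x y hxy h
    refine (dist_le x y).trans ?_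
    rw [abs_sub_comm, abs_of_nonneg (sub_nonneg.2 (pos_mono hxy))]
    have hy := grp_lt y
    have h₁ := pos_mono (k := k) (show y.grp ≤ x.grp + 1 by omega)
    rw [pos_succ] at h₁
    rcases hxy.eq_or_lt with e | hlt
    · rw [e]
      linarith
    · have h₂ : (x.grp : ℝ) + 2 ≤ 2 * k := by exact_mod_cast (by omega : x.grp + 2 ≤ 2 * k)
      linarith
  simp only [pairing, mem_image, mem_range]
  rintro _ ⟨t, -, rfl⟩ x hx y hy
  rw [mem_filter] at hx hy
  rcases le_total x.grp y.grp with h | h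
  · exact hle x y h (by omega)
  · rw [dist_comm]
    exact hle y x h (by omega)

end GroupedPoint

/-- Lower bound on the maximum diameter of average-link: there is a constant `c > 0` such
that for every sufficiently large `k` there exist a finite metric space and an execution
of average-link whose `k`-clustering `A^k` satisfies `max-diam(A^k) ≥ c · k · OPT_DM(k)`. -/
theorem avgLink_maxDiam_lower_bound :
    ∃ c : ℝ, 0 < c ∧ ∃ k₀ : ℕ, ∀ k : ℕ, k₀ ≤ k →
      ∃ (X : Type) (m : MetricSpace X) (f : Fintype X) (de : DecidableEq X),
        @BadForAvgLink c k X m f de := by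
  refine ⟨1 / 3, by norm_num, 1, fun k hk =>
    ⟨GroupedPoint k, inferInstance, inferInstance, inferInstance, ?_⟩⟩
  obtain ⟨E, hE⟩ := GroupedPoint.exists_avgLinkExec_chain hk
  refine ⟨E, ?_⟩
  have hopt : sInf {r : ℝ | ∃ 𝒞 : Finset (Finset (GroupedPoint k)),
      IsClustering 𝒞 k ∧ r = maxDiam dist 𝒞} ≤ 6 * k := by
    refine le_trans (csInf_le ⟨0, ?_⟩ ⟨_, GroupedPoint.isClustering_pairing k, rfl⟩)
      (GroupedPoint.maxDiam_pairing_le hk)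
    rintro _ ⟨𝒞, -, rfl⟩
    exact maxDiam_nonneg 𝒞
  rw [hE]
  calc 1 / 3 * (k : ℝ) * sInf {r : ℝ | ∃ 𝒞 : Finset (Finset (GroupedPoint k)),
      IsClustering 𝒞 k ∧ r = maxDiam dist 𝒞} ≤ 1 / 3 * (k : ℝ) * (6 * k) := by gcongr
    _ = 2 * (k : ℝ) ^ 2 := by ring
    _ ≤ _ := GroupedPoint.le_maxDiam_chain hk
end
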